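/- Let R be a skew-invertible Hecke symmetry on V = ℂ^N with parameter q (q ≠ 0, q ≠ ±1) and let L(R) be the associated reflection equation algebra with generating matrix L. For every n ≥ 1, the n-th power sum simplifies: Tr_{R(1…n)}( R_{n−1} R_{n−2} ⋯ R₁ · L_{\bar{1→n}} ) = Tr_R( L^n ), where L^n is the n-th matrix power of L over L(R) and Tr_R(L^n) = Σ_{i,j} C_i^j (L^n)_j^i. -/

import Mathlib

open scoped BigOperators

/-- Amplification of an operator on V⊗V to positions (k, k+1) (0-based) of V^{⊗n}. -/
def ampl2 {A : Type*} [Semiring A] (N n : ℕ)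
    (M : Matrix (Fin N × Fin N) (Fin N × Fin N) A) (k : ℕ) :
    Matrix (Fin n → Fin N) (Fin n → Fin N) A := fun i j =>
  if h : k + 1 < n then
    if ∀ m : Fin n, (m : ℕ) ≠ k → (m : ℕ) ≠ k + 1 → i m = j m then
      M (i ⟨k, Nat.lt_of_succ_lt h⟩, i ⟨k + 1, h⟩)
        (j ⟨k, Nat.lt_of_succ_lt h⟩, j ⟨k + 1, h⟩)
    else 0
  else 0

/-- Amplification of an operator on V to position k (0-based) of V^{⊗n}. -/
def ampl1 {A : Type*} [Semiring A] (N n : ℕ)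
    (X : Matrix (Fin N) (Fin N) A) (k : ℕ) :
    Matrix (Fin n → Fin N) (Fin n → Fin N) A := fun i j =>
  if h : k < n then
    if ∀ m : Fin n, (m : ℕ) ≠ k → i m = j m then
      X (i ⟨k, h⟩) (j ⟨k, h⟩)
    else 0
  else 0

/-- The R-trace of an N×N matrix over an algebra. -/
noncomputable def trR1 {A : Type*} [Ring A] [Algebra ℂ A] (N : ℕ)
    (C : Matrix (Fin N) (Fin N) ℂ) (X : Matrix (Fin N) (Fin N) A) : A :=
  ∑ i : Fin N, ∑ j : Fin N, algebraMap ℂ A (C i j) * X j i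

/-- The full R-trace over all n tensor positions. -/
noncomputable def trRn {A : Type*} [Ring A] [Algebra ℂ A] (N n : ℕ)
    (C : Matrix (Fin N) (Fin N) ℂ)
    (M : Matrix (Fin n → Fin N) (Fin n → Fin N) A) : A :=
  ∑ i : Fin n → Fin N, ∑ j : Fin n → Fin N,
    algebraMap ℂ A (∏ k : Fin n, C (i k) (j k)) * M j i

/-- The matrix L⊗I over the free algebra on N² generators. -/
noncomputable def L1F (N : ℕ) :
    Matrix (Fin N × Fin N) (Fin N × Fin N) (FreeAlgebra ℂ (Fin N × Fin N)) :=
  fun p r => if p.2 = r.2 then FreeAlgebra.ι ℂ (p.1, r.1) else 0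

/-- Defining relations of the reflection equation algebra. -/
inductive REArel (N : ℕ) (R : Matrix (Fin N × Fin N) (Fin N × Fin N) ℂ) :
    FreeAlgebra ℂ (Fin N × Fin N) → FreeAlgebra ℂ (Fin N × Fin N) → Prop
  | rel (p r : Fin N × Fin N) :
      REArel N R
        ((R.map (algebraMap ℂ (FreeAlgebra ℂ (Fin N × Fin N))) * L1F N *
            R.map (algebraMap ℂ (FreeAlgebra ℂ (Fin N × Fin N))) * L1F N) p r)
        ((L1F N * R.map (algebraMap ℂ (FreeAlgebra ℂ (Fin N × Fin N))) * L1F N *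
            R.map (algebraMap ℂ (FreeAlgebra ℂ (Fin N × Fin N)))) p r)

/-- The reflection equation algebra L(R). -/
abbrev REA (N : ℕ) (R : Matrix (Fin N × Fin N) (Fin N × Fin N) ℂ) := RingQuot (REArel N R)

/-- The generating matrix of the RE algebra. -/
noncomputable def Lgen (N : ℕ) (R : Matrix (Fin N × Fin N) (Fin N × Fin N) ℂ) :
    Matrix (Fin N) (Fin N) (REA N R) :=
  fun i j => RingQuot.mkAlgHom ℂ (REArel N R) (FreeAlgebra.ι ℂ (i, j))

/-- Defining relations of the modified reflection equation algebra. -/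
inductive MREArel (N : ℕ) (R : Matrix (Fin N × Fin N) (Fin N × Fin N) ℂ) :
    FreeAlgebra ℂ (Fin N × Fin N) → FreeAlgebra ℂ (Fin N × Fin N) → Prop
  | rel (p r : Fin N × Fin N) :
      MREArel N R
        ((R.map (algebraMap ℂ (FreeAlgebra ℂ (Fin N × Fin N))) * L1F N *
            R.map (algebraMap ℂ (FreeAlgebra ℂ (Fin N × Fin N))) * L1F N -
          L1F N * R.map (algebraMap ℂ (FreeAlgebra ℂ (Fin N × Fin N))) * L1F N *
            R.map (algebraMap ℂ (FreeAlgebra ℂ (Fin N × Fin N)))) p r)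
        ((R.map (algebraMap ℂ (FreeAlgebra ℂ (Fin N × Fin N))) * L1F N -
          L1F N * R.map (algebraMap ℂ (FreeAlgebra ℂ (Fin N × Fin N)))) p r)

/-- The modified reflection equation algebra L̂(R). -/
abbrev MREA (N : ℕ) (R : Matrix (Fin N × Fin N) (Fin N × Fin N) ℂ) := RingQuot (MREArel N R)

/-- The generating matrix of the modified RE algebra. -/
noncomputable def Lhatgen (N : ℕ) (R : Matrix (Fin N × Fin N) (Fin N × Fin N) ℂ) :
    Matrix (Fin N) (Fin N) (MREA N R) :=
  fun i j => RingQuot.mkAlgHom ℂ (MREArel N R) (FreeAlgebra.ι ℂ (i, j))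

/-- The matrices L_{\bar k}, 0-based: Lbar 0 = L₁, Lbar k = R_k Lbar (k-1) R_k⁻¹,
with R⁻¹ = R - (q - q⁻¹)I. -/
noncomputable def Lbar {A : Type*} [Ring A] [Algebra ℂ A] (N n : ℕ)
    (R : Matrix (Fin N × Fin N) (Fin N × Fin N) ℂ) (q : ℂ)
    (L : Matrix (Fin N) (Fin N) A) : ℕ → Matrix (Fin n → Fin N) (Fin n → Fin N) A
  | 0 => ampl1 N n L 0
  | k + 1 =>
      ampl2 N n (R.map (algebraMap ℂ A)) k * Lbar N n R q L k *
        ampl2 N n ((R - (q - q⁻¹) • 1).map (algebraMap ℂ A)) k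

/-- The ordered product L_{\bar 1} L_{\bar 2} ⋯ L_{\bar n}. -/
noncomputable def Ltot {A : Type*} [Ring A] [Algebra ℂ A] (N n : ℕ)
    (R : Matrix (Fin N × Fin N) (Fin N × Fin N) ℂ) (q : ℂ)
    (L : Matrix (Fin N) (Fin N) A) : Matrix (Fin n → Fin N) (Fin n → Fin N) A :=
  ((List.range n).map (Lbar N n R q L)).prod


open scoped Classical in
/-- Amplification along a map of index sets. -/
noncomputable def ampG {α κ S A : Type*} [Semiring A] (f : α → κ)
    (M : Matrix (α → S) (α → S) A) : Matrix (κ → S) (κ → S) A := fun i j =>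
  if ∀ x, x ∉ Set.range f → i x = j x then M (i ∘ f) (j ∘ f) else 0

theorem ampG_mul {α κ S A : Type*} [Fintype α] [Fintype κ] [Fintype S] [DecidableEq α]
    [DecidableEq κ] [Semiring A] (f : α → κ) (hf : Function.Injective f)
    (M M' : Matrix (α → S) (α → S) A) : ampG f (M * M') = ampG f M * ampG f M' := by
  classical
  ext i k
  simp only [ampG, Matrix.mul_apply]
  by_cases h : ∀ x, x ∉ Set.range f → i x = k x
  · rw [if_pos h]
    symm
    have key : ∀ j : α → S, (Function.extend f j i) ∘ f = j := fun j => by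
      funext a; simp [hf.extend_apply]
    refine Finset.sum_bij_ne_zero (fun j _ _ => j ∘ f) (fun _ _ _ => Finset.mem_univ _) ?_ ?_ ?_
    · intro j₁ _ h₁ j₂ _ h₂ h12
      have e₁ : ∀ x, x ∉ Set.range f → i x = j₁ x := by
        by_contra hc; rw [if_neg hc] at h₁; simp at h₁
      have e₂ : ∀ x, x ∉ Set.range f → i x = j₂ x := by
        by_contra hc; rw [if_neg hc] at h₂; simp at h₂
      funext x
      by_cases hx : x ∈ Set.range f
      · obtain ⟨a, rfl⟩ := hx
        exact congrFun h12 a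
      · rw [← e₁ x hx, ← e₂ x hx]
    · intro j _ hj
      refine ⟨Function.extend f j i, Finset.mem_univ _, ?_, key j⟩
      rw [if_pos, if_pos, key]
      · exact hj
      · intro x hx
        rw [Function.extend_apply' _ _ _ hx]; exact h x hx
      · intro x hx
        rw [Function.extend_apply' _ _ _ hx]
    · intro j _ hj
      have e₁ : ∀ x, x ∉ Set.range f → i x = j x := by
        by_contra hc; rw [if_neg hc] at hj; simp at hj
      rw [if_pos e₁, if_pos]
      intro x hx
      rw [← e₁ x hx]; exact h x hx
  · rw [if_neg h]
    symm
    apply Finset.sum_eq_zero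
    intro j _
    by_cases h1 : ∀ x, x ∉ Set.range f → i x = j x
    · rw [if_neg (c := ∀ x, x ∉ Set.range f → j x = k x), mul_zero]
      intro h2
      exact h fun x hx => (h1 x hx).trans (h2 x hx)
    · rw [if_neg h1, zero_mul]

theorem ampG_one {α κ S A : Type*} [DecidableEq (α → S)] [DecidableEq (κ → S)]
    [Semiring A] (f : α → κ) :
    ampG f (1 : Matrix (α → S) (α → S) A) = 1 := by
  classical
  ext i k
  simp only [ampG, Matrix.one_apply]
  by_cases h : i = k
  · subst h; simp
  · rw [if_neg h]
    split_ifs with h1 h2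
    · exfalso
      apply h
      funext x
      by_cases hx : x ∈ Set.range f
      · obtain ⟨a, rfl⟩ := hx
        exact congrFun h2 a
      · exact h1 x hx
    · rfl
    · rfl

theorem ampG_comp {α β κ S A : Type*} [Semiring A] (f : α → β) (g : β → κ)
    (hg : Function.Injective g)
    (M : Matrix (α → S) (α → S) A) : ampG g (ampG f M) = ampG (g ∘ f) M := by
  classical
  ext i k
  simp only [ampG]
  by_cases h : ∀ x, x ∉ Set.range (g ∘ f) → i x = k x
  · rw [if_pos h, if_pos, if_pos]
    · rfl
    · intro x hx
      apply h
      rintro ⟨a, ha⟩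
      exact hx ⟨a, hg ha⟩
    · intro x hx
      apply h
      rintro ⟨a, rfl⟩
      exact hx ⟨f a, rfl⟩
  · rw [if_neg h]
    split_ifs with h1 h2
    · exfalso
      apply h
      intro x hx
      by_cases hx' : x ∈ Set.range g
      · obtain ⟨b, rfl⟩ := hx'
        apply h2
        rintro ⟨a, rfl⟩
        exact hx ⟨a, rfl⟩
      · exact h1 x hx'
    · rfl
    · rfl

theorem ampG_mul_disj {α β κ S A : Type*} [Fintype κ] [Fintype S] [DecidableEq κ]
    [Semiring A] (f : α → κ) (g : β → κ)
    (hd : ∀ a b, f a ≠ g b) (M : Matrix (α → S) (α → S) A) (M' : Matrix (β → S) (β → S) A)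
    (i k : κ → S) [Decidable (∀ x, x ∉ Set.range f → x ∉ Set.range g → i x = k x)] :
    (ampG f M * ampG g M') i k =
      if ∀ x, x ∉ Set.range f → x ∉ Set.range g → i x = k x then
        M (i ∘ f) (k ∘ f) * M' (i ∘ g) (k ∘ g) else 0 := by
  classical
  simp only [ampG, Matrix.mul_apply]
  rw [Finset.sum_eq_single (fun x => if x ∈ Set.range f then k x else i x)]
  · rw [if_pos]
    · have e1 : (fun x => if x ∈ Set.range f then k x else i x) ∘ f = k ∘ f := by
        funext a; simp
      have e2 : (fun x => if x ∈ Set.range f then k x else i x) ∘ g = i ∘ g := by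
        funext b; simp [hd]
      rw [e1, e2]
      by_cases h : ∀ x, x ∉ Set.range f → x ∉ Set.range g → i x = k x
      · rw [if_pos h, if_pos]
        intro x hx
        by_cases hxf : x ∈ Set.range f
        · simp [hxf]
        · simp only [if_neg hxf]; exact h x hxf hx
      · rw [if_neg h, if_neg, mul_zero]
        intro h'
        apply h
        intro x hxf hxg
        have := h' x hxg
        simpa only [if_neg hxf] using this
    · intro x hx
      simp only [if_neg hx]
  · intro j _ hj
    by_cases h1 : ∀ x, x ∉ Set.range f → i x = j x
    · rw [if_neg (c := ∀ x, x ∉ Set.range g → j x = k x), mul_zero]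
      intro h2
      apply hj
      funext x
      by_cases hx : x ∈ Set.range f
      · rw [if_pos hx]
        apply h2
        rintro ⟨b, rfl⟩
        obtain ⟨a, ha⟩ := hx
        exact hd a b ha
      · rw [if_neg hx, h1 x hx]
    · rw [if_neg h1, zero_mul]
  · simp

theorem ampG_commute {α β κ S A : Type*} [Fintype κ] [Fintype S] [DecidableEq κ]
    [Semiring A] (f : α → κ) (g : β → κ)
    (hd : ∀ a b, f a ≠ g b) (M : Matrix (α → S) (α → S) A) (M' : Matrix (β → S) (β → S) A)
    (hc : ∀ a b c d, Commute (M a b) (M' c d)) : Commute (ampG f M) (ampG g M') := by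
  classical
  unfold Commute SemiconjBy
  ext i k
  rw [ampG_mul_disj f g hd, ampG_mul_disj g f (fun a b => (hd b a).symm)]
  rw [(hc _ _ _ _).eq]
  congr 1
  apply propext
  exact ⟨fun h x a b => h x b a, fun h x a b => h x b a⟩

/-- Two-site matrix with index set `Fin 2 → S`. -/
def two {S A : Type*} (M : Matrix (S × S) (S × S) A) : Matrix (Fin 2 → S) (Fin 2 → S) A :=
  M.submatrix (finTwoArrowEquiv S) (finTwoArrowEquiv S)

/-- One-site matrix with index set `Fin 1 → S`. -/
def one1 {S A : Type*} (M : Matrix S S A) : Matrix (Fin 1 → S) (Fin 1 → S) A :=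
  M.submatrix (Equiv.funUnique (Fin 1) S) (Equiv.funUnique (Fin 1) S)

theorem ampl2_eq {A : Type*} [Semiring A] (N n : ℕ)
    (M : Matrix (Fin N × Fin N) (Fin N × Fin N) A) (k : ℕ) (h : k + 1 < n) :
    ampl2 N n M k = ampG ![(⟨k, Nat.lt_of_succ_lt h⟩ : Fin n), ⟨k + 1, h⟩] (two M) := by
  classical
  ext i j
  simp only [ampl2, dif_pos h, ampG, two, Matrix.submatrix_apply]
  have : (∀ m : Fin n, (m : ℕ) ≠ k → (m : ℕ) ≠ k + 1 → i m = j m) ↔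
    (∀ x, x ∉ Set.range ![(⟨k, Nat.lt_of_succ_lt h⟩ : Fin n), ⟨k + 1, h⟩] → i x = j x) := by
    apply forall_congr'
    intro m
    simp only [Set.mem_range, Fin.exists_fin_two, Fin.ext_iff]
    simp [Fin.ext_iff]
    grind
  by_cases hc : ∀ m : Fin n, (m : ℕ) ≠ k → (m : ℕ) ≠ k + 1 → i m = j m
  · rw [if_pos hc, if_pos (this.1 hc)]; rfl
  · rw [if_neg hc, if_neg (fun h' => hc (this.2 h'))]

theorem ampl1_eq {A : Type*} [Semiring A] (N n : ℕ)
    (M : Matrix (Fin N) (Fin N) A) (k : ℕ) (h : k < n) :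
    ampl1 N n M k = ampG (fun _ : Fin 1 => (⟨k, h⟩ : Fin n)) (one1 M) := by
  classical
  ext i j
  simp only [ampl1, dif_pos h, ampG, one1, Matrix.submatrix_apply]
  have : (∀ m : Fin n, (m : ℕ) ≠ k → i m = j m) ↔
    (∀ x, x ∉ Set.range (fun _ : Fin 1 => (⟨k, h⟩ : Fin n)) → i x = j x) := by
    apply forall_congr'
    intro m
    simp [Fin.ext_iff, eq_comm]
  by_cases hc : ∀ m : Fin n, (m : ℕ) ≠ k → i m = j m
  · rw [if_pos hc, if_pos (this.1 hc)]; rfl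
  · rw [if_neg hc, if_neg (fun h' => hc (this.2 h'))]

theorem two_inj {n k : ℕ} (h : k + 1 < n) :
    Function.Injective ![(⟨k, Nat.lt_of_succ_lt h⟩ : Fin n), ⟨k + 1, h⟩] := by
  intro a b
  fin_cases a <;> fin_cases b <;> simp

theorem ampl2_mul {A : Type*} [Semiring A] (N n : ℕ)
    (M M' : Matrix (Fin N × Fin N) (Fin N × Fin N) A) (k : ℕ) :
    ampl2 N n (M * M') k = ampl2 N n M k * ampl2 N n M' k := by
  by_cases h : k + 1 < n
  · rw [ampl2_eq _ _ _ _ h, ampl2_eq _ _ _ _ h, ampl2_eq _ _ _ _ h, ← ampG_mul _ (two_inj h)]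
    congr 1
    simp only [two, Matrix.submatrix_mul_equiv]
  · have : ∀ M : Matrix (Fin N × Fin N) (Fin N × Fin N) A, ampl2 N n M k = 0 := by
      intro M; ext i j; simp [ampl2, h]
    simp [this]

theorem ampl2_one {A : Type*} [Semiring A] (N n : ℕ) (k : ℕ) (h : k + 1 < n) :
    ampl2 N n (1 : Matrix (Fin N × Fin N) (Fin N × Fin N) A) k = 1 := by
  rw [ampl2_eq _ _ _ _ h]
  have : two (1 : Matrix (Fin N × Fin N) (Fin N × Fin N) A) = 1 := by
    exact Matrix.submatrix_one_equiv _
  rw [this, ampG_one]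

theorem ampl1_mul {A : Type*} [Semiring A] (N n : ℕ)
    (M M' : Matrix (Fin N) (Fin N) A) (k : ℕ) :
    ampl1 N n (M * M') k = ampl1 N n M k * ampl1 N n M' k := by
  by_cases h : k < n
  · rw [ampl1_eq _ _ _ _ h, ampl1_eq _ _ _ _ h, ampl1_eq _ _ _ _ h, ← ampG_mul]
    · congr 1
      simp only [one1, Matrix.submatrix_mul_equiv]
    · intro a b _; exact Subsingleton.elim a b
  · have : ∀ M : Matrix (Fin N) (Fin N) A, ampl1 N n M k = 0 := by
      intro M; ext i j; simp [ampl1, h]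
    simp [this]

theorem ampl2_zero' {A : Type*} [Semiring A] (N n : ℕ)
    (M : Matrix (Fin N × Fin N) (Fin N × Fin N) A) (k : ℕ) (h : ¬ k + 1 < n) :
    ampl2 N n M k = 0 := by
  ext i j; simp [ampl2, h]

theorem ampl2_far {A : Type*} [Semiring A] (N n : ℕ)
    (M M' : Matrix (Fin N × Fin N) (Fin N × Fin N) A) (j k : ℕ) (hjk : j + 2 ≤ k)
    (hc : ∀ a b c d, Commute (M a b) (M' c d)) :
    Commute (ampl2 N n M j) (ampl2 N n M' k) := by
  by_cases h : k + 1 < n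
  · rw [ampl2_eq _ _ _ _ h, ampl2_eq _ _ _ j (by omega)]
    apply ampG_commute
    · intro a b
      fin_cases a <;> fin_cases b <;> simp [Fin.ext_iff] <;> omega
    · intros; apply hc
  · rw [ampl2_zero' _ _ _ _ h]; exact Commute.zero_right _

theorem ampl1_far {A : Type*} [Semiring A] (N n : ℕ)
    (M : Matrix (Fin N) (Fin N) A)
    (M' : Matrix (Fin N × Fin N) (Fin N × Fin N) A) (k : ℕ) (hk : 1 ≤ k)
    (hc : ∀ a b c d, Commute (M a b) (M' c d)) :
    Commute (ampl1 N n M 0) (ampl2 N n M' k) := by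
  by_cases h : k + 1 < n
  · rw [ampl2_eq _ _ _ _ h, ampl1_eq _ _ _ 0 (by omega)]
    apply ampG_commute
    · intro a b
      fin_cases b <;> simp [Fin.ext_iff] <;> omega
    · intros; apply hc
  · rw [ampl2_zero' _ _ _ _ h]; exact Commute.zero_right _

theorem ampl2_braid {A : Type*} [Semiring A] (N n : ℕ)
    (M : Matrix (Fin N × Fin N) (Fin N × Fin N) A)
    (hb : ampl2 N 3 M 0 * ampl2 N 3 M 1 * ampl2 N 3 M 0 =
      ampl2 N 3 M 1 * ampl2 N 3 M 0 * ampl2 N 3 M 1) (k : ℕ) (h : k + 2 < n) :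
    ampl2 N n M k * ampl2 N n M (k + 1) * ampl2 N n M k =
      ampl2 N n M (k + 1) * ampl2 N n M k * ampl2 N n M (k + 1) := by
  let g : Fin 3 → Fin n := fun x => ⟨k + x, by omega⟩
  have hg : Function.Injective g := by
    intro a b hab
    simp only [g, Fin.mk.injEq] at hab
    omega
  have e0 : ampl2 N n M k = ampG g (ampl2 N 3 M 0) := by
    rw [ampl2_eq _ _ _ _ (by omega), ampl2_eq _ _ _ _ (by omega), ampG_comp _ _ hg]
    congr 1
    funext x
    fin_cases x <;> rfl
  have e1 : ampl2 N n M (k + 1) = ampG g (ampl2 N 3 M 1) := by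
    rw [ampl2_eq _ _ _ _ (by omega), ampl2_eq _ _ _ _ (by omega), ampG_comp _ _ hg]
    congr 1
    funext x
    fin_cases x <;> rfl
  rw [e0, e1, ← ampG_mul _ hg, ← ampG_mul _ hg, ← ampG_mul _ hg, ← ampG_mul _ hg, hb]

theorem ampl_RE {A : Type*} [Semiring A] (N n : ℕ)
    (M : Matrix (Fin N × Fin N) (Fin N × Fin N) A) (L : Matrix (Fin N) (Fin N) A)
    (L1 : Matrix (Fin N × Fin N) (Fin N × Fin N) A)
    (hL1 : L1 = fun p r => if p.2 = r.2 then L p.1 r.1 else 0)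
    (hb : M * L1 * M * L1 = L1 * M * L1 * M) (h : 1 < n) :
    ampl2 N n M 0 * ampl1 N n L 0 * ampl2 N n M 0 * ampl1 N n L 0 =
      ampl1 N n L 0 * ampl2 N n M 0 * ampl1 N n L 0 * ampl2 N n M 0 := by
  have e : ampl1 N n L 0 = ampl2 N n L1 0 := by
    ext i j
    rw [hL1]
    simp only [ampl1, ampl2]
    rw [dif_pos (by omega), dif_pos (by omega)]
    by_cases h1 : ∀ m : Fin n, (m : ℕ) ≠ 0 → i m = j m
    · rw [if_pos h1, if_pos (fun m hm _ => h1 m hm), if_pos]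
      exact h1 _ (by simp)
    · rw [if_neg h1]
      split_ifs with h2 h3
      · exfalso
        apply h1
        intro m hm
        by_cases hm1 : (m : ℕ) = 1
        · have : m = ⟨0 + 1, h⟩ := Fin.ext (by simp [hm1])
          rw [this]; exact h3
        · exact h2 m hm (by omega)
      · rfl
      · rfl
  rw [e, ← ampl2_mul, ← ampl2_mul, ← ampl2_mul, hb, ampl2_mul, ampl2_mul, ampl2_mul]

/-! Abstract ring part -/

section abstractPart

variable {B : Type*} [Ring B] (r s Lb : ℕ → B) (n : ℕ)

theorem abs_A (hrs : ∀ k, k + 1 < n → r k * s k = 1) (hsr : ∀ k, k + 1 < n → s k * r k = 1)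
    (hLb : ∀ k, Lb (k + 1) = r k * Lb k * s k)
    (hfar : ∀ j k, j + 2 ≤ k → Commute (r j) (r k))
    (hfar' : ∀ j k, j + 2 ≤ k → Commute (s j) (r k))
    (hl : ∀ k, 1 ≤ k → Commute (Lb 0) (r k)) (k m : ℕ) (hkm : k < m) :
    Commute (Lb k) (r m) := by
  induction k with
  | zero => exact hl m hkm
  | succ k ih =>
    rw [hLb]
    exact ((hfar _ _ (by omega)).mul_left (ih (by omega))).mul_left (hfar' _ _ (by omega))

theorem abs_B (hrs : ∀ k, k + 1 < n → r k * s k = 1) (hsr : ∀ k, k + 1 < n → s k * r k = 1)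
    (hLb : ∀ k, Lb (k + 1) = r k * Lb k * s k)
    (hbr : ∀ k, k + 2 < n → r k * r (k + 1) * r k = r (k + 1) * r k * r (k + 1))
    (hfar : ∀ j k, j + 2 ≤ k → Commute (r j) (r k))
    (hfar'' : ∀ j k, j + 2 ≤ k → Commute (r j) (s k))
    (hA : ∀ k m, k < m → Commute (Lb k) (r m)) (m k : ℕ) (hmk : m + 2 ≤ k) (hk : k < n) :
    Commute (r m) (Lb k) := by
  induction k, hmk using Nat.le_induction with
  | base =>
    have h1 := hbr m hk
    have h2 : r (m + 1) * (s m * s (m + 1)) = s m * s (m + 1) * r m := by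
      calc r (m + 1) * (s m * s (m + 1))
          = (s m * (s (m + 1) * r (m + 1)) * r m) * (r (m + 1) * (s m * s (m + 1))) := by
            rw [hsr _ (by omega), mul_one, hsr _ (by omega), one_mul]
        _ = s m * s (m + 1) * (r (m + 1) * r m * r (m + 1)) * s m * s (m + 1) := by
            simp only [mul_assoc]
        _ = s m * s (m + 1) * r m * (r (m + 1) * (r m * s m) * s (m + 1)) := by
            rw [← h1]; simp only [mul_assoc]
        _ = _ := by
            rw [hrs _ (by omega), mul_one, hrs _ (by omega), mul_one]
    rw [hLb, hLb]
    unfold Commute SemiconjBy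
    calc r m * (r (m + 1) * (r m * Lb m * s m) * s (m + 1))
        = (r m * r (m + 1) * r m) * Lb m * (s m * s (m + 1)) := by simp only [mul_assoc]
      _ = r (m + 1) * r m * (r (m + 1) * Lb m) * (s m * s (m + 1)) := by
          rw [h1]; simp only [mul_assoc]
      _ = r (m + 1) * r m * Lb m * (r (m + 1) * (s m * s (m + 1))) := by
          rw [← (hA m (m + 1) (by omega)).eq]; simp only [mul_assoc]
      _ = _ := by rw [h2]; simp only [mul_assoc]
  | succ k hk' ih =>
    rw [hLb]
    exact ((hfar _ _ hk').mul_right (ih (by omega))).mul_right (hfar'' _ _ hk')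

theorem abs_C (hrs : ∀ k, k + 1 < n → r k * s k = 1) (hsr : ∀ k, k + 1 < n → s k * r k = 1)
    (hLb : ∀ k, Lb (k + 1) = r k * Lb k * s k)
    (hbr : ∀ k, k + 2 < n → r k * r (k + 1) * r k = r (k + 1) * r k * r (k + 1))
    (hRE : 1 < n → r 0 * Lb 0 * r 0 * Lb 0 = Lb 0 * r 0 * Lb 0 * r 0)
    (hA : ∀ k m, k < m → Commute (Lb k) (r m))
    (hB : ∀ m k, m + 2 ≤ k → k < n → Commute (r m) (Lb k)) (m : ℕ) (hm : m + 1 < n) :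
    Commute (r m) (Lb m * Lb (m + 1)) := by
  induction m with
  | zero =>
    unfold Commute SemiconjBy
    rw [hLb]
    calc r 0 * (Lb 0 * (r 0 * Lb 0 * s 0)) = (r 0 * Lb 0 * r 0 * Lb 0) * s 0 := by
            simp only [mul_assoc]
      _ = Lb 0 * r 0 * Lb 0 * (r 0 * s 0) := by rw [hRE hm]; simp only [mul_assoc]
      _ = Lb 0 * r 0 * Lb 0 * (s 0 * r 0) := by rw [hrs _ hm, hsr _ hm]
      _ = _ := by simp only [mul_assoc]
  | succ m ih =>
    have ih := (ih (by omega)).eq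
    have e1 := hrs m (by omega)
    have e2 := hrs (m + 1) (by omega)
    have e3 := hsr m (by omega)
    have e4 := hsr (m + 1) (by omega)
    have hb := hbr m hm
    -- g = r m * r (m+1) conjugates
    have c0 : r m * r (m + 1) * r m = r (m + 1) * (r m * r (m + 1)) := by
      rw [hb]; simp only [mul_assoc]
    have c1 : r m * r (m + 1) * Lb m = Lb (m + 1) * (r m * r (m + 1)) := by
      calc r m * r (m + 1) * Lb m = r m * (r (m + 1) * Lb m) := by simp only [mul_assoc]
        _ = r m * Lb m * r (m + 1) := by
          rw [← (hA m (m + 1) (by omega)).eq]; simp only [mul_assoc]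
        _ = r m * Lb m * (s m * r m) * r (m + 1) := by rw [e3, mul_one]
        _ = _ := by rw [hLb m]; simp only [mul_assoc]
    have c2 : r m * r (m + 1) * Lb (m + 1) = Lb (m + 2) * (r m * r (m + 1)) := by
      calc r m * r (m + 1) * Lb (m + 1)
          = r m * r (m + 1) * Lb (m + 1) * (s (m + 1) * r (m + 1)) := by rw [e4, mul_one]
        _ = r m * Lb (m + 2) * r (m + 1) := by rw [hLb (m + 1)]; simp only [mul_assoc]
        _ = _ := by rw [(hB m (m + 2) le_rfl hm).eq]; simp only [mul_assoc]
    have e5 : r m * r (m + 1) * (s (m + 1) * s m) = 1 := by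
      calc r m * r (m + 1) * (s (m + 1) * s m) = r m * (r (m + 1) * s (m + 1)) * s m := by
            simp only [mul_assoc]
        _ = 1 := by rw [e2, mul_one, e1]
    generalize r m * r (m + 1) = g at *
    generalize s (m + 1) * s m = gi at *
    unfold Commute SemiconjBy
    have key : r (m + 1) * (Lb (m + 1) * Lb (m + 2)) * g
        = (Lb (m + 1) * Lb (m + 2)) * r (m + 1) * g := by
      calc r (m + 1) * (Lb (m + 1) * Lb (m + 2)) * g
          = r (m + 1) * Lb (m + 1) * (Lb (m + 2) * g) := by simp only [mul_assoc]
        _ = r (m + 1) * (Lb (m + 1) * g) * Lb (m + 1) := by rw [← c2]; simp only [mul_assoc]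
        _ = (r (m + 1) * g) * Lb m * Lb (m + 1) := by rw [← c1]; simp only [mul_assoc]
        _ = g * (r m * (Lb m * Lb (m + 1))) := by rw [← c0]; simp only [mul_assoc]
        _ = (g * Lb m) * Lb (m + 1) * r m := by rw [ih]; simp only [mul_assoc]
        _ = Lb (m + 1) * (g * Lb (m + 1)) * r m := by rw [c1]; simp only [mul_assoc]
        _ = Lb (m + 1) * Lb (m + 2) * (g * r m) := by rw [c2]; simp only [mul_assoc]
        _ = _ := by rw [c0]; simp only [mul_assoc]
    have := congrArg (· * gi) key
    simpa only [mul_assoc, e5, mul_one] using this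

theorem abs_D (hA : ∀ k m, k < m → Commute (Lb k) (r m))
    (hB : ∀ m k, m + 2 ≤ k → k < n → Commute (r m) (Lb k))
    (hC : ∀ m, m + 1 < n → Commute (r m) (Lb m * Lb (m + 1)))
    (m p : ℕ) (hmp : m + 2 ≤ p) (hp : p ≤ n) :
    Commute (r m) ((List.range p).map Lb).prod := by
  induction p, hmp using Nat.le_induction with
  | base =>
    rw [List.range_succ, List.range_succ]
    simp only [List.map_append, List.prod_append, List.map_cons, List.map_nil,
      List.prod_singleton, mul_assoc]
    refine Commute.mul_right ?_ (hC m (by omega))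
    apply Commute.list_prod_right
    intro x hx
    simp only [List.mem_map, List.mem_range] at hx
    obtain ⟨k, hk, rfl⟩ := hx
    exact (hA k m hk).symm
  | succ p hmp ih =>
    rw [List.range_succ]
    simp only [List.map_append, List.prod_append, List.map_cons, List.map_nil,
      List.prod_singleton]
    exact (ih (by omega)).mul_right (hB m p hmp (by omega))

theorem revprod_succ (p : ℕ) : ((List.range (p + 1)).reverse.map r).prod =
    r p * ((List.range p).reverse.map r).prod := by
  rw [List.range_succ]; simp

theorem abs_E (hsr : ∀ k, k + 1 < n → s k * r k = 1)
    (hLb : ∀ k, Lb (k + 1) = r k * Lb k * s k) (p : ℕ) (hp : p < n) :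
    Lb p * ((List.range p).reverse.map r).prod = ((List.range p).reverse.map r).prod * Lb 0 := by
  induction p with
  | zero => simp
  | succ p ih =>
    rw [revprod_succ, hLb, mul_assoc (r p) _ (Lb 0), ← ih (by omega)]
    calc r p * Lb p * s p * (r p * ((List.range p).reverse.map r).prod)
        = r p * Lb p * (s p * r p) * ((List.range p).reverse.map r).prod := by
          simp only [mul_assoc]
      _ = _ := by rw [hsr p hp]; simp only [mul_assoc, mul_one, one_mul]

end abstractPart

/-! Partial trace -/

/-- Extension by one tensor factor on the right. -/
noncomputable def extS {A : Type*} [Semiring A] (N n : ℕ)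
    (M : Matrix (Fin n → Fin N) (Fin n → Fin N) A) :
    Matrix (Fin (n + 1) → Fin N) (Fin (n + 1) → Fin N) A := ampG (Fin.castSucc) M

theorem extS_mul {A : Type*} [Semiring A] (N n : ℕ)
    (M M' : Matrix (Fin n → Fin N) (Fin n → Fin N) A) :
    extS N n (M * M') = extS N n M * extS N n M' :=
  ampG_mul _ (Fin.castSucc_injective n) _ _

theorem extS_one {A : Type*} [Semiring A] (N n : ℕ) :
    extS N n (1 : Matrix (Fin n → Fin N) (Fin n → Fin N) A) = 1 := ampG_one _

theorem extS_prod {A : Type*} [Semiring A] (N n : ℕ)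
    (l : List (Matrix (Fin n → Fin N) (Fin n → Fin N) A)) :
    extS N n l.prod = (l.map (extS N n)).prod := by
  induction l with
  | nil => simp [extS_one]
  | cons a l ih => simp [extS_mul, ih]

theorem extS_pow {A : Type*} [Semiring A] (N n : ℕ)
    (M : Matrix (Fin n → Fin N) (Fin n → Fin N) A) (k : ℕ) :
    extS N n (M ^ k) = extS N n M ^ k := by
  induction k with
  | zero => simp [extS_one]
  | succ k ih => rw [pow_succ, pow_succ, extS_mul, ih]

theorem extS_apply {A : Type*} [Semiring A] (N n : ℕ)
    (M : Matrix (Fin n → Fin N) (Fin n → Fin N) A) (i j : Fin n → Fin N) (a b : Fin N) :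
    extS N n M (Fin.snoc (α := fun _ => Fin N) i a) (Fin.snoc (α := fun _ => Fin N) j b)
      = if a = b then M i j else 0 := by
  classical
  unfold extS ampG
  have e : ∀ (i : Fin n → Fin N) (a : Fin N),
      (Fin.snoc (α := fun _ => Fin N) i a : Fin (n + 1) → Fin N) ∘ Fin.castSucc = i := by
    intro i a; funext x; simp
  rw [e, e]
  congr 1
  apply propext
  constructor
  · intro h
    have := h (Fin.last n) (by rintro ⟨x, hx⟩; exact (Fin.castSucc_lt_last x).ne hx)
    simpa using this
  · intro h x hx
    induction x using Fin.lastCases with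
    | last => simpa using h
    | cast x => exact absurd ⟨x, rfl⟩ hx

theorem extS_ampl2 {A : Type*} [Semiring A] (N n : ℕ)
    (M : Matrix (Fin N × Fin N) (Fin N × Fin N) A) (k : ℕ) (h : k + 1 < n) :
    extS N n (ampl2 N n M k) = ampl2 N (n + 1) M k := by
  rw [extS, ampl2_eq _ _ _ _ h, ampl2_eq _ _ _ _ (by omega),
    ampG_comp _ _ (Fin.castSucc_injective n)]
  congr 1
  funext x
  fin_cases x <;> rfl

theorem extS_ampl1 {A : Type*} [Semiring A] (N n : ℕ)
    (M : Matrix (Fin N) (Fin N) A) (k : ℕ) (h : k < n) :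
    extS N n (ampl1 N n M k) = ampl1 N (n + 1) M k := by
  rw [extS, ampl1_eq _ _ _ _ h, ampl1_eq _ _ _ _ (by omega),
    ampG_comp _ _ (Fin.castSucc_injective n)]
  rfl

theorem extS_Lbar {A : Type*} [Ring A] [Algebra ℂ A] (N n : ℕ)
    (R : Matrix (Fin N × Fin N) (Fin N × Fin N) ℂ) (q : ℂ)
    (L : Matrix (Fin N) (Fin N) A) (k : ℕ) (h : k < n) :
    extS N n (Lbar N n R q L k) = Lbar N (n + 1) R q L k := by
  induction k with
  | zero => exact extS_ampl1 _ _ _ _ h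
  | succ k ih =>
    simp only [Lbar]
    rw [extS_mul, extS_mul, ih (by omega), extS_ampl2 _ _ _ _ h, extS_ampl2 _ _ _ _ h]

/-- Partial R-trace over the last factor. -/
noncomputable def ptr {A : Type*} [Ring A] [Algebra ℂ A] (N n : ℕ)
    (C : Matrix (Fin N) (Fin N) ℂ)
    (M : Matrix (Fin (n + 1) → Fin N) (Fin (n + 1) → Fin N) A) :
    Matrix (Fin n → Fin N) (Fin n → Fin N) A := fun j i =>
  ∑ a : Fin N, ∑ b : Fin N, algebraMap ℂ A (C a b) *
    M (Fin.snoc (α := fun _ => Fin N) j b) (Fin.snoc (α := fun _ => Fin N) i a)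

theorem sum_snoc {A : Type*} [AddCommMonoid A] (N n : ℕ) (f : (Fin (n + 1) → Fin N) → A) :
    ∑ i, f i = ∑ i : Fin n → Fin N, ∑ a : Fin N, f (Fin.snoc (α := fun _ => Fin N) i a) := by
  rw [← (Fin.snocEquiv (fun _ : Fin (n + 1) => Fin N)).sum_comp, Fintype.sum_prod_type,
    Finset.sum_comm]
  rfl

theorem trRn_ptr {A : Type*} [Ring A] [Algebra ℂ A] (N n : ℕ)
    (C : Matrix (Fin N) (Fin N) ℂ)
    (M : Matrix (Fin (n + 1) → Fin N) (Fin (n + 1) → Fin N) A) :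
    trRn N (n + 1) C M = trRn N n C (ptr N n C M) := by
  unfold trRn ptr
  rw [sum_snoc]
  simp_rw [sum_snoc N n (fun j => _ * _)]
  refine Finset.sum_congr rfl fun i _ => ?_
  rw [Finset.sum_comm]
  refine Finset.sum_congr rfl fun j _ => ?_
  rw [Finset.mul_sum]
  refine Finset.sum_congr rfl fun a _ => ?_
  rw [Finset.mul_sum]
  refine Finset.sum_congr rfl fun b _ => ?_
  rw [Fin.prod_univ_castSucc]
  simp [mul_assoc]

theorem ptr_mul {A : Type*} [Ring A] [Algebra ℂ A] (N n : ℕ)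
    (C : Matrix (Fin N) (Fin N) ℂ)
    (X Y : Matrix (Fin n → Fin N) (Fin n → Fin N) A)
    (M : Matrix (Fin (n + 1) → Fin N) (Fin (n + 1) → Fin N) A) :
    ptr N n C (extS N n X * M * extS N n Y) = X * ptr N n C M * Y := by
  have hl : ptr N n C (extS N n X * M) = X * ptr N n C M := by
    ext j i
    simp only [ptr, Matrix.mul_apply, sum_snoc N n, extS_apply, ite_mul, zero_mul,
      Finset.sum_ite_eq, Finset.mem_univ, if_true, Finset.mul_sum]
    rw [Finset.sum_comm_cycle]
    refine Finset.sum_congr rfl fun x _ => ?_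
    refine Finset.sum_congr rfl fun a _ => ?_
    refine Finset.sum_congr rfl fun b _ => ?_
    rw [← mul_assoc, Algebra.commutes, mul_assoc]
  have hr : ∀ M, ptr N n C (M * extS N n Y) = ptr N n C M * Y := by
    intro M
    ext j i
    simp only [ptr, Matrix.mul_apply, sum_snoc N n, extS_apply, mul_ite, mul_zero,
      Finset.sum_ite_eq', Finset.mem_univ, if_true, Finset.mul_sum, Finset.sum_mul]
    rw [Finset.sum_comm_cycle]
    refine Finset.sum_congr rfl fun x _ => ?_
    refine Finset.sum_congr rfl fun a _ => ?_
    refine Finset.sum_congr rfl fun b _ => ?_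
    rw [mul_assoc]
  rw [hr, hl]

theorem ptr_R {A : Type*} [Ring A] [Algebra ℂ A] (N m : ℕ)
    (C : Matrix (Fin N) (Fin N) ℂ) (R : Matrix (Fin N × Fin N) (Fin N × Fin N) ℂ)
    (hRC : ∀ i j, ∑ a, ∑ b, C a b * R (i, b) (j, a) = if i = j then 1 else 0) :
    ptr N (m + 1) C (ampl2 N (m + 2) (R.map (algebraMap ℂ A)) m) = 1 := by
  ext j i
  unfold ptr ampl2
  have hs0 : ∀ (i : Fin (m + 1) → Fin N) (a : Fin N) (h : m < m + 2),
    (Fin.snoc (α := fun _ => Fin N) i a : Fin (m + 2) → Fin N) ⟨m, h⟩ = i (Fin.last m) := by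
    intro i a h
    have : (⟨m, h⟩ : Fin (m + 2)) = Fin.castSucc (Fin.last m) := rfl
    rw [this, Fin.snoc_castSucc]
  have hs1 : ∀ (i : Fin (m + 1) → Fin N) (a : Fin N) (h : m + 1 < m + 2),
    (Fin.snoc (α := fun _ => Fin N) i a : Fin (m + 2) → Fin N) ⟨m + 1, h⟩ = a := by
    intro i a h
    have : (⟨m + 1, h⟩ : Fin (m + 2)) = Fin.last (m + 1) := rfl
    rw [this, Fin.snoc_last]
  have hcond : ∀ a b : Fin N, (∀ x : Fin (m + 2), (x : ℕ) ≠ m → (x : ℕ) ≠ m + 1 →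
      (Fin.snoc (α := fun _ => Fin N) j b : Fin (m + 2) → Fin N) x =
      (Fin.snoc (α := fun _ => Fin N) i a : Fin (m + 2) → Fin N) x) ↔
      ∀ x : Fin (m + 1), x ≠ Fin.last m → j x = i x := by
    intro a b
    constructor
    · intro h x hx
      have := h x.castSucc (fun h' => hx (Fin.ext h')) (by simpa using x.2.ne)
      simpa only [Fin.snoc_castSucc] using this
    · intro h x h1 h2
      induction x using Fin.lastCases with
      | last => simp at h2
      | cast x =>
        simp only [Fin.snoc_castSucc]
        exact h x (fun h' => h1 (by simp [h']))
  simp only [hcond, hs0, hs1, Matrix.map_apply]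
  simp only [dif_pos (show m + 1 < m + 2 by omega)]
  by_cases hc : ∀ x : Fin (m + 1), x ≠ Fin.last m → j x = i x
  · simp only [if_pos hc, ← map_mul, ← map_sum, hRC]
    by_cases hji : j = i
    · subst hji; simp
    · rw [Matrix.one_apply_ne hji, if_neg, map_zero]
      intro h
      apply hji
      funext x
      by_cases hx : x = Fin.last m
      · rw [hx, h]
      · exact hc x hx
  · simp only [if_neg hc, mul_zero, Finset.sum_const_zero]
    rw [Matrix.one_apply_ne]
    rintro rfl
    exact hc fun _ _ => rfl

theorem trRn_one {A : Type*} [Ring A] [Algebra ℂ A] (N : ℕ)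
    (C : Matrix (Fin N) (Fin N) ℂ) (X : Matrix (Fin N) (Fin N) A) :
    trRn N 1 C (ampl1 N 1 X 0) = trR1 N C X := by
  unfold trRn trR1
  rw [← (Equiv.funUnique (Fin 1) (Fin N)).symm.sum_comp]
  refine Finset.sum_congr rfl fun i _ => ?_
  rw [← (Equiv.funUnique (Fin 1) (Fin N)).symm.sum_comp]
  refine Finset.sum_congr rfl fun j _ => ?_
  simp only [ampl1, Fin.prod_univ_one, zero_lt_one, dif_pos]
  rw [if_pos]
  · rfl
  · intro m hm; exact absurd (by omega) hm

theorem ampl1_pow {A : Type*} [Semiring A] (N n : ℕ)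
    (X : Matrix (Fin N) (Fin N) A) (k : ℕ) :
    ampl1 N n (X ^ (k + 1)) 0 = ampl1 N n X 0 ^ (k + 1) := by
  induction k with
  | zero => simp
  | succ k ih => rw [pow_succ, ampl1_mul, ih, ← pow_succ]

section mainPart

variable {A : Type*} [Ring A] [Algebra ℂ A] (N : ℕ) (q : ℂ) 
    (R : Matrix (Fin N × Fin N) (Fin N × Fin N) ℂ) (L : Matrix (Fin N) (Fin N) A)

theorem main_sr (hsr : (R - (q - q⁻¹) • 1) * R = 1) (n k : ℕ) (h : k + 1 < n) :
    ampl2 N n ((R - (q - q⁻¹) • 1).map (algebraMap ℂ A)) k *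
      ampl2 N n (R.map (algebraMap ℂ A)) k = 1 := by
  rw [← ampl2_mul, ← Matrix.map_mul, hsr, Matrix.map_one _ (map_zero _) (map_one _),
    ampl2_one _ _ _ h]

theorem main_rs (hrs : R * (R - (q - q⁻¹) • 1) = 1) (n k : ℕ) (h : k + 1 < n) :
    ampl2 N n (R.map (algebraMap ℂ A)) k *
    ampl2 N n ((R - (q - q⁻¹) • 1).map (algebraMap ℂ A)) k = 1 := by
  rw [← ampl2_mul, ← Matrix.map_mul, hrs, Matrix.map_one _ (map_zero _) (map_one _),
    ampl2_one _ _ _ h]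

theorem main_trace (C : Matrix (Fin N) (Fin N) ℂ)
    (hRC : ∀ i j, ∑ a, ∑ b, C a b * R (i, b) (j, a) = if i = j then 1 else 0)
    (hsr : (R - (q - q⁻¹) • 1) * R = 1) (m : ℕ) : ∀ k : ℕ,
    trRn N (m + 1) C (Ltot N (m + 1) R q L *
      ((List.range m).reverse.map
        (fun k => ampl2 N (m + 1) (R.map (algebraMap ℂ A)) k)).prod *
      ampl1 N (m + 1) L 0 ^ k) = trR1 N C (L ^ (m + 1 + k)) := by
  induction m with
  | zero =>
    intro k
    rw [← trRn_one]
    congr 1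
    rw [show 0 + 1 + k = k + 1 by ring, ampl1_pow]
    simp [Ltot, Lbar, pow_succ', List.range_succ]
  | succ m ih =>
    intro k
    rw [show m + 1 + 1 + k = m + 1 + (k + 1) by ring, ← ih (k + 1), trRn_ptr]
    congr 1
    have e := abs_E (fun k => ampl2 N (m + 2) (R.map (algebraMap ℂ A)) k)
      (fun k => ampl2 N (m + 2) ((R - (q - q⁻¹) • 1).map (algebraMap ℂ A)) k)
      (Lbar N (m + 2) R q L) (m + 2) (fun k hk => main_sr N q R hsr _ k hk)
      (fun k => rfl) (m + 1) (by omega)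
    have eL : Ltot N (m + 1 + 1) R q L =
        extS N (m + 1) (Ltot N (m + 1) R q L) * Lbar N (m + 2) R q L (m + 1) := by
      unfold Ltot
      rw [List.range_succ (n := m + 1), extS_prod]
      simp only [List.map_append, List.prod_append, List.map_cons, List.map_nil,
        List.prod_singleton, List.map_map]
      congr 2
      apply List.map_congr_left
      intro x hx
      exact (extS_Lbar _ _ _ _ _ _ (List.mem_range.1 hx)).symm
    have eQ : ((List.range m).reverse.map
        (fun k => ampl2 N (m + 2) (R.map (algebraMap ℂ A)) k)).prod =
        extS N (m + 1) ((List.range m).reverse.map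
        (fun k => ampl2 N (m + 1) (R.map (algebraMap ℂ A)) k)).prod := by
      rw [extS_prod, List.map_map]
      congr 1
      apply List.map_congr_left
      intro x hx
      have : x < m := by simpa using hx
      exact (extS_ampl2 _ _ _ _ (by omega)).symm
    have e0 : ampl1 N (m + 2) L 0 = extS N (m + 1) (ampl1 N (m + 1) L 0) :=
      (extS_ampl1 _ _ _ _ (by omega)).symm
    have e' : Lbar N (m + 2) R q L 0 = ampl1 N (m + 2) L 0 := rfl
    rw [eL, mul_assoc (extS _ _ _), e, revprod_succ, e', eQ, e0]
    have : ∀ a r b c d : Matrix (Fin (m + 1 + 1) → Fin N) (Fin (m + 1 + 1) → Fin N) A,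
        a * (r * b * c) * d = a * r * (b * (c * d)) := by
      intros; simp only [mul_assoc]
    rw [this, ← pow_succ', ← extS_pow, ← extS_mul, ptr_mul, ptr_R N m C R hRC]
    simp only [mul_assoc, one_mul]

theorem main_comm (hsr : (R - (q - q⁻¹) • 1) * R = 1) (hrs : R * (R - (q - q⁻¹) • 1) = 1)
    (hbraid : ampl2 N 3 R 0 * ampl2 N 3 R 1 * ampl2 N 3 R 0 =
      ampl2 N 3 R 1 * ampl2 N 3 R 0 * ampl2 N 3 R 1)
    (L1 : Matrix (Fin N × Fin N) (Fin N × Fin N) A)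
    (hL1 : L1 = fun p r => if p.2 = r.2 then L p.1 r.1 else 0)
    (hRE : R.map (algebraMap ℂ A) * L1 * R.map (algebraMap ℂ A) * L1 =
      L1 * R.map (algebraMap ℂ A) * L1 * R.map (algebraMap ℂ A)) (n m : ℕ) (hm : m + 2 ≤ n) :
    Commute (ampl2 N n (R.map (algebraMap ℂ A)) m) (Ltot N n R q L) := by
  have hmap : ∀ k, (ampl2 N 3 R k).map (algebraMap ℂ A) =
      ampl2 N 3 (R.map (algebraMap ℂ A)) k := by
    intro k
    ext i j
    simp only [Matrix.map_apply, ampl2]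
    split_ifs <;> simp
  have hb := congrArg (fun M => Matrix.map M (algebraMap ℂ A)) hbraid
  simp only [Matrix.map_mul, hmap] at hb
  have hA := abs_A (fun k => ampl2 N n (R.map (algebraMap ℂ A)) k)
      (fun k => ampl2 N n ((R - (q - q⁻¹) • 1).map (algebraMap ℂ A)) k)
      (Lbar N n R q L) n (fun k hk => main_rs N q R hrs _ k hk)
      (fun k hk => main_sr N q R hsr _ k hk)
      (fun k => rfl)
      (fun j k h => ampl2_far _ _ _ _ _ _ h fun _ _ _ _ => Algebra.commutes _ _)
      (fun j k h => ampl2_far _ _ _ _ _ _ h fun _ _ _ _ => Algebra.commutes _ _)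
      (fun k h => ampl1_far _ _ _ _ _ h fun _ _ _ _ => (Algebra.commutes _ _).symm)
  have hB := abs_B (fun k => ampl2 N n (R.map (algebraMap ℂ A)) k)
      (fun k => ampl2 N n ((R - (q - q⁻¹) • 1).map (algebraMap ℂ A)) k)
      (Lbar N n R q L) n (fun k hk => main_rs N q R hrs _ k hk)
      (fun k hk => main_sr N q R hsr _ k hk)
      (fun k => rfl)
      (fun k hk => ampl2_braid _ _ _ hb k hk)
      (fun j k h => ampl2_far _ _ _ _ _ _ h fun _ _ _ _ => Algebra.commutes _ _)
      (fun j k h => ampl2_far _ _ _ _ _ _ h fun _ _ _ _ => Algebra.commutes _ _)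
      hA
  have hC := abs_C (fun k => ampl2 N n (R.map (algebraMap ℂ A)) k)
      (fun k => ampl2 N n ((R - (q - q⁻¹) • 1).map (algebraMap ℂ A)) k)
      (Lbar N n R q L) n (fun k hk => main_rs N q R hrs _ k hk)
      (fun k hk => main_sr N q R hsr _ k hk)
      (fun k => rfl)
      (fun k hk => ampl2_braid _ _ _ hb k hk)
      (fun h => ampl_RE N n _ L L1 hL1 hRE h)
      hA hB
  exact abs_D (fun k => ampl2 N n (R.map (algebraMap ℂ A)) k) (Lbar N n R q L) n hA hB hC
    m n hm le_rfl

end mainPart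

theorem REA_RE (N : ℕ) (R : Matrix (Fin N × Fin N) (Fin N × Fin N) ℂ)
    (L1 : Matrix (Fin N × Fin N) (Fin N × Fin N) (REA N R))
    (hL1 : L1 = fun p r => if p.2 = r.2 then Lgen N R p.1 r.1 else 0) :
    R.map (algebraMap ℂ (REA N R)) * L1 * R.map (algebraMap ℂ (REA N R)) * L1 =
      L1 * R.map (algebraMap ℂ (REA N R)) * L1 * R.map (algebraMap ℂ (REA N R)) := by
  have e1 : L1 = (L1F N).map (RingQuot.mkAlgHom ℂ (REArel N R)) := by
    rw [hL1]
    ext p r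
    simp only [Matrix.map_apply, L1F, Lgen]
    split_ifs <;> simp
  have e2 : R.map (algebraMap ℂ (REA N R)) =
      (R.map (algebraMap ℂ (FreeAlgebra ℂ (Fin N × Fin N)))).map
        (RingQuot.mkAlgHom ℂ (REArel N R)) := by
    ext p r
    simp only [Matrix.map_apply, AlgHom.commutes]
  rw [e1, e2]
  simp only [← Matrix.map_mul]
  ext p r
  exact RingQuot.mkAlgHom_rel ℂ (REArel.rel p r)

/-- Tr_{R(1…n)}( R_{n−1} ⋯ R₁ · L_{\bar{1→n}} ) = Tr_R( Lⁿ ) in L(R). -/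
theorem statement_8 (N : ℕ) (hN : 1 ≤ N) (q : ℂ) (hq0 : q ≠ 0) (hq1 : q ≠ 1) (hqm1 : q ≠ -1)
    (R : Matrix (Fin N × Fin N) (Fin N × Fin N) ℂ)
    (hbraid : ampl2 N 3 R 0 * ampl2 N 3 R 1 * ampl2 N 3 R 0 =
      ampl2 N 3 R 1 * ampl2 N 3 R 0 * ampl2 N 3 R 1)
    (hHecke : (q • (1 : Matrix (Fin N × Fin N) (Fin N × Fin N) ℂ) - R) * (q⁻¹ • 1 + R) = 0)
    (Ψ : Matrix (Fin N × Fin N) (Fin N × Fin N) ℂ)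
    (hΨ : ∀ i j k m : Fin N, ∑ a : Fin N, ∑ b : Fin N,
        R (i, b) (j, a) * Ψ (a, k) (b, m) = if i = m ∧ k = j then 1 else 0)
    (C : Matrix (Fin N) (Fin N) ℂ)
    (hC : ∀ i j : Fin N, C i j = ∑ k : Fin N, Ψ (i, k) (j, k))
    (n : ℕ) (hn : 1 ≤ n) :
    trRn N n C
      ((((List.range (n - 1)).reverse.map
          (fun k => ampl2 N n (R.map (algebraMap ℂ (REA N R))) k)).prod) *
        Ltot N n R q (Lgen N R)) =
      trR1 N C (Lgen N R ^ n) := by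
  have hexp : R * R = (q - q⁻¹) • R + 1 := by
    have h := hHecke
    simp only [sub_mul, mul_add, smul_mul_assoc, mul_smul_comm, one_mul, mul_one, smul_sub,
      smul_smul, inv_mul_cancel₀ hq0, one_smul] at h
    rw [sub_smul, ← sub_eq_zero, ← neg_eq_zero, ← h]
    abel
  have hrs : R * (R - (q - q⁻¹) • 1) = 1 := by
    rw [mul_sub, hexp, mul_smul_comm, mul_one]; abel
  have hsr : (R - (q - q⁻¹) • 1) * R = 1 := by
    rw [sub_mul, hexp, smul_mul_assoc, one_mul]; abel
  have hRC : ∀ i j, ∑ a, ∑ b, C a b * R (i, b) (j, a) = if i = j then 1 else 0 := by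
    intro i j
    have : ∑ a, ∑ b, C a b * R (i, b) (j, a) =
        ∑ k, ∑ a, ∑ b, R (i, b) (j, a) * Ψ (a, k) (b, k) := by
      rw [← Finset.sum_comm_cycle]
      refine Finset.sum_congr rfl fun a _ => ?_
      refine Finset.sum_congr rfl fun b _ => ?_
      rw [hC, mul_comm, Finset.mul_sum]
    rw [this]
    simp only [hΨ]
    by_cases hij : i = j
    · subst hij
      simp [eq_comm]
    · rw [if_neg hij]
      apply Finset.sum_eq_zero
      intro k _
      rw [if_neg]
      rintro ⟨rfl, h⟩
      exact hij h
  obtain ⟨m, rfl⟩ : ∃ m, n = m + 1 := ⟨n - 1, by omega⟩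
  have hcomm : Commute (((List.range m).reverse.map
        (fun k => ampl2 N (m + 1) (R.map (algebraMap ℂ (REA N R))) k)).prod)
        (Ltot N (m + 1) R q (Lgen N R)) := by
    apply Commute.list_prod_left
    intro x hx
    simp only [List.mem_map, List.mem_reverse, List.mem_range] at hx
    obtain ⟨k, hk, rfl⟩ := hx
    exact main_comm N q R (Lgen N R) hsr hrs hbraid _ rfl (REA_RE N R _ rfl) _ _ (by omega)
  have := main_trace N q R (Lgen N R) C hRC hsr m 0
  rw [pow_zero, mul_one, ← hcomm.eq] at this
  exact this
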